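/- Let a, b, c be positive real numbers with b² − 4ac = 1, set Q(X,Y) = aX² + bXY + cY², and let α, β ∈ ℝ∖ℤ. For M, N ∈ ℕ and s ∈ ℂ set S_{M,N}(s) := Σ_{p=1}^{M} Σ_{q=0}^{N} e^{2πi(pα+qβ)} · Q(p,q)^{−s}. Then there exists a function Z, holomorphic (complex differentiable) on the half-plane {s ∈ ℂ : Re(s) > 1/2}, such that S_{M,N} converges to Z locally uniformly on {Re(s) > 1/2} as (M,N) → (∞,∞) along the product filter; moreover, for Re(s) > 1 the double series Σ_{p≥1, q≥0} e^{2πi(pα+qβ)} Q(p,q)^{−s} converges absolutely with sum Z(s). -/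

import Mathlib

open Complex MeasureTheory Filter Topology Set Asymptotics

noncomputable section

/-- `e2pi θ = e^{2πiθ}`. -/
def e2pi (θ : ℝ) : ℂ := Complex.exp (2 * Real.pi * Complex.I * θ)

/-- The indefinite binary quadratic form `Q(X,Y) = aX² + bXY + cY²`. -/
def Qform (a b c : ℝ) (X Y : ℝ) : ℝ := a * X ^ 2 + b * X * Y + c * Y ^ 2

theorem aux_sbp (w : ℂ) (f : ℕ → ℂ) (N : ℕ) :
    (w - 1) * ∑ q ∈ Finset.range (N + 1), w ^ q * f q =
      w ^ (N + 1) * f N - f 0 - ∑ q ∈ Finset.range N, w ^ (q + 1) * (f (q + 1) - f q) := by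
  induction N with
  | zero => simp; ring
  | succ n ih =>
    rw [Finset.sum_range_succ, mul_add, ih, Finset.sum_range_succ _ n]
    ring

theorem aux_rect : Tendsto (fun MN : ℕ × ℕ => Finset.range MN.1 ×ˢ Finset.range MN.2)
    atTop atTop := by
  refine tendsto_atTop_finset_of_monotone ?_ ?_
  · intro x y h
    exact Finset.product_subset_product (Finset.range_mono h.1) (Finset.range_mono h.2)
  · rintro ⟨p, q⟩
    exact ⟨(p + 1, q + 1), by simp⟩

theorem aux_rect1 : Tendsto (fun MN : ℕ × ℕ => Finset.range MN.1 ×ˢ Finset.range (MN.2 + 1))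
    atTop atTop := by
  refine tendsto_atTop_finset_of_monotone ?_ ?_
  · intro x y h
    exact Finset.product_subset_product (Finset.range_mono h.1)
      (Finset.range_mono (Nat.succ_le_succ h.2))
  · rintro ⟨p, q⟩
    exact ⟨(p + 1, q + 1), by simp⟩

theorem aux_uniform (f : ℕ → ℕ → ℂ → ℂ) (E : ℕ → ℂ) (hE : ∀ p, ‖E p‖ = 1) (w : ℂ)
    (hw : w ≠ 1) (hw1 : ‖w‖ = 1) (K : Set ℂ) (u : ℕ × ℕ → ℝ) (hu : Summable u)
    (v : ℕ → ℝ) (hv : Summable v) (hv0 : ∀ p, 0 ≤ v p)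
    (t : ℕ → ℝ) (ht : Tendsto t atTop (𝓝 0)) (ht0 : ∀ n, 0 ≤ t n)
    (hd : ∀ p q, ∀ s ∈ K, ‖f p (q + 1) s - f p q s‖ ≤ u (p, q))
    (hf : ∀ p q, ∀ s ∈ K, ‖f p q s‖ ≤ v p * t q) :
    TendstoUniformlyOn
      (fun (MN : ℕ × ℕ) (s : ℂ) =>
        ∑ p ∈ Finset.range MN.1, ∑ q ∈ Finset.range (MN.2 + 1), E p * w ^ q * f p q s)
      (fun s => (w - 1)⁻¹ * (0 - (∑' p, E p * f p 0 s) -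
        ∑' pq : ℕ × ℕ, E pq.1 * w ^ (pq.2 + 1) * (f pq.1 (pq.2 + 1) s - f pq.1 pq.2 s)))
      atTop K := by
  have hw' : w - 1 ≠ 0 := sub_ne_zero.2 hw
  have h1 : TendstoUniformlyOn (fun (MN : ℕ × ℕ) (s : ℂ) =>
      ∑ p ∈ Finset.range MN.1, E p * f p 0 s) (fun s => ∑' p, E p * f p 0 s) atTop K := by
    have := tendstoUniformlyOn_tsum (f := fun p s => E p * f p 0 s) (s := K)
      (hv.mul_right (t 0)) (by
        intro p s hs
        rw [norm_mul, hE, one_mul]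
        exact hf p 0 s hs)
    intro U hU
    have h2 : Tendsto (fun MN : ℕ × ℕ => Finset.range MN.1) atTop atTop := by
      rw [← prod_atTop_atTop_eq]
      exact tendsto_finset_range.comp tendsto_fst
    exact h2.eventually (this U hU)
  have h2 : TendstoUniformlyOn (fun (MN : ℕ × ℕ) (s : ℂ) =>
      ∑ pq ∈ Finset.range MN.1 ×ˢ Finset.range MN.2,
        E pq.1 * w ^ (pq.2 + 1) * (f pq.1 (pq.2 + 1) s - f pq.1 pq.2 s))
      (fun s => ∑' pq : ℕ × ℕ, E pq.1 * w ^ (pq.2 + 1) *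
        (f pq.1 (pq.2 + 1) s - f pq.1 pq.2 s)) atTop K := by
    have := tendstoUniformlyOn_tsum (f := fun (pq : ℕ × ℕ) s => E pq.1 * w ^ (pq.2 + 1) *
        (f pq.1 (pq.2 + 1) s - f pq.1 pq.2 s)) (s := K) hu (by
        intro p s hs
        rw [norm_mul, norm_mul, norm_pow, hw1, hE, one_pow, one_mul, one_mul]
        exact hd p.1 p.2 s hs)
    intro U hU
    exact aux_rect.eventually (this U hU)
  have h0 : TendstoUniformlyOn (fun (MN : ℕ × ℕ) (s : ℂ) =>
      ∑ p ∈ Finset.range MN.1, E p * w ^ (MN.2 + 1) * f p MN.2 s) (fun _ => 0) atTop K := by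
    rw [Metric.tendstoUniformlyOn_iff]
    intro ε hε
    have ht2 : Tendsto (fun MN : ℕ × ℕ => (∑' p, v p) * t MN.2) atTop (𝓝 0) := by
      rw [← prod_atTop_atTop_eq]
      simpa using (ht.comp tendsto_snd).const_mul (∑' p, v p)
    filter_upwards [ht2.eventually (gt_mem_nhds hε)] with MN hMN s hs
    rw [dist_zero_left]
    refine lt_of_le_of_lt ?_ hMN
    calc _ ≤ ∑ p ∈ Finset.range MN.1, ‖E p * w ^ (MN.2 + 1) * f p MN.2 s‖ := norm_sum_le _ _
      _ ≤ ∑ p ∈ Finset.range MN.1, v p * t MN.2 := by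
        refine Finset.sum_le_sum fun p _ => ?_
        rw [norm_mul, norm_mul, norm_pow, hw1, hE, one_pow, one_mul, one_mul]
        exact hf p _ s hs
      _ = (∑ p ∈ Finset.range MN.1, v p) * t MN.2 := by rw [Finset.sum_mul]
      _ ≤ _ := mul_le_mul_of_nonneg_right (hv.sum_le_tsum _ fun p _ => hv0 p) (ht0 _)
  have huc : UniformContinuous (fun z : ℂ => (w - 1)⁻¹ * z) := uniformContinuous_const_smul (w - 1)⁻¹
  have h3 := huc.comp_tendstoUniformlyOn ((h0.sub h1).sub h2)
  refine h3.congr (Eventually.of_forall fun MN s _ => ?_)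
  simp only [Function.comp, Pi.sub_apply]
  rw [inv_mul_eq_iff_eq_mul₀ hw', Finset.mul_sum, Finset.sum_product, ← Finset.sum_sub_distrib,
    ← Finset.sum_sub_distrib]
  refine Finset.sum_congr rfl fun p _ => ?_
  have := aux_sbp w (fun q => f p q s) MN.2
  simp only [mul_assoc]
  simp only [← Finset.mul_sum]
  linear_combination (-E p) * this

theorem aux_cpow (s : ℂ) (hs : 0 < s.re) (x y : ℝ) (hx : 0 < x) (hxy : x ≤ y) :
    ‖(y : ℂ) ^ (-s) - (x : ℂ) ^ (-s)‖ ≤ ‖s‖ * x ^ (-s.re - 1) * (y - x) := by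
  have hs0 : -s ≠ 0 := by
    intro h
    have : s = 0 := by simpa using h
    simp [this] at hs
  refine norm_image_sub_le_of_norm_deriv_le_segment' (f := fun t : ℝ => (t : ℂ) ^ (-s))
    (f' := fun t : ℝ => -s * (t : ℂ) ^ (-s - 1)) ?_ ?_ y (right_mem_Icc.2 hxy)
  · intro t ht
    have ht0 : t ≠ 0 := (hx.trans_le ht.1).ne'
    have h1 : HasDerivAt (fun z : ℂ => z ^ (-s)) (-s * (t : ℂ) ^ (-s - 1)) (t : ℂ) :=
      by simpa using (hasDerivAt_id (t : ℂ)).cpow_const (c := -s)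
          (Or.inl (by simpa using hx.trans_le ht.1))
    exact h1.comp_ofReal.hasDerivWithinAt
  · intro t ht
    have ht0 : 0 < t := hx.trans_le ht.1
    rw [norm_mul, norm_neg, norm_cpow_eq_rpow_re_of_pos ht0]
    refine mul_le_mul_of_nonneg_left ?_ (norm_nonneg _)
    simp only [sub_re, neg_re, one_re]
    exact Real.rpow_le_rpow_of_nonpos hx ht.1 (by linarith)

/-- lower bound of the form -/
theorem aux_Q (a b c : ℝ) (ha : 0 < a) (hb : 0 < b) (hc : 0 < c) :
    ∃ m : ℝ, 0 < m ∧ m ≤ 1 ∧ ∀ p q : ℕ,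
      m * ((p : ℝ) + 1 + q) ^ 2 ≤ Qform a b c ((p : ℝ) + 1) q := by
  refine ⟨min 1 (min a (min (b / 2) c)), by positivity, min_le_left _ _, fun p q => ?_⟩
  set m := min 1 (min a (min (b / 2) c)) with hm
  have h1 : m ≤ a := (min_le_right _ _).trans (min_le_left _ _)
  have h2 : m ≤ b / 2 := (min_le_right _ _).trans ((min_le_right _ _).trans (min_le_left _ _))
  have h3 : m ≤ c := (min_le_right _ _).trans ((min_le_right _ _).trans (min_le_right _ _))
  unfold Qform
  have e1 := mul_le_mul_of_nonneg_right h1 (sq_nonneg ((p : ℝ) + 1))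
  have e2 := mul_le_mul_of_nonneg_right h2 (show (0 : ℝ) ≤ ((p : ℝ) + 1) * q by positivity)
  have e3 := mul_le_mul_of_nonneg_right h3 (sq_nonneg (q : ℝ))
  nlinarith

/-- power bound -/
theorem aux_pow (m n x σ σ₀ R : ℝ) (hm : 0 < m) (hm1 : m ≤ 1) (hn : 1 ≤ n) (hx : m * n ^ 2 ≤ x)
    (hσ₀ : 0 ≤ σ₀) (h1 : σ₀ ≤ σ) (h2 : σ ≤ R) : x ^ (-σ) ≤ m ^ (-R) * n ^ (-(2 * σ₀)) := by
  have hn0 : 0 < n := by linarith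
  calc x ^ (-σ) ≤ (m * n ^ 2) ^ (-σ) :=
        Real.rpow_le_rpow_of_nonpos (by positivity) hx (by linarith)
    _ = m ^ (-σ) * n ^ (-(2 * σ)) := by
        rw [Real.mul_rpow hm.le (by positivity), ← Real.rpow_natCast n 2, ← Real.rpow_mul hn0.le]
        congr 2
        push_cast; ring
    _ ≤ _ := by
        refine mul_le_mul ?_ ?_ (by positivity) (by positivity)
        · exact Real.rpow_le_rpow_of_exponent_ge hm hm1 (by linarith)
        · exact Real.rpow_le_rpow_of_exponent_le hn (by linarith)

theorem aux_split (p q : ℕ) (x y : ℝ) (hx : 0 ≤ x) (hy : 0 ≤ y) :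
    ((p : ℝ) + 1 + q) ^ (-(x + y)) ≤ ((p : ℝ) + 1) ^ (-x) * ((q : ℝ) + 1) ^ (-y) := by
  have h : (0 : ℝ) < (p : ℝ) + 1 + q := by positivity
  rw [neg_add, Real.rpow_add h]
  refine mul_le_mul ?_ ?_ (by positivity) (by positivity)
  · exact Real.rpow_le_rpow_of_nonpos (by positivity) (by linarith [(Nat.cast_nonneg q : (0:ℝ) ≤ q)])
      (by linarith)
  · exact Real.rpow_le_rpow_of_nonpos (by positivity) (by linarith [(Nat.cast_nonneg p : (0:ℝ) ≤ p)])
      (by linarith)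

theorem aux_summable (x : ℝ) (hx : 1 < x) : Summable fun p : ℕ => ((p : ℝ) + 1) ^ (-x) := by
  have := (summable_nat_add_iff 1).2 (Real.summable_nat_rpow.2 (show -x < -1 by linarith))
  simpa using this

theorem aux_summable2 (x : ℝ) (hx : 1 < x) :
    Summable fun pq : ℕ × ℕ => ((pq.1 : ℝ) + 1) ^ (-x) * ((pq.2 : ℝ) + 1) ^ (-x) :=
  (aux_summable x hx).mul_of_nonneg (aux_summable x hx) (fun p => by positivity)
    (fun p => by positivity)

theorem aux_norm_e (θ : ℝ) : ‖e2pi θ‖ = 1 := by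
  have : e2pi θ = Complex.exp ((2 * Real.pi * θ : ℝ) * Complex.I) := by
    unfold e2pi; congr 1; push_cast; ring
  rw [this, Complex.norm_exp_ofReal_mul_I]

theorem aux_e_mul (x y : ℝ) (q : ℕ) : e2pi (x + q * y) = e2pi x * e2pi y ^ q := by
  unfold e2pi
  rw [← Complex.exp_nat_mul, ← Complex.exp_add]
  congr 1; push_cast; ring

theorem aux_e_ne (β : ℝ) (hβ : ∀ n : ℤ, β ≠ n) : e2pi β ≠ 1 := by
  intro h
  obtain ⟨n, hn⟩ := Complex.exp_eq_one_iff.1 h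
  have h2 : (2 * Real.pi * Complex.I : ℂ) ≠ 0 := Complex.two_pi_I_ne_zero
  have h3 : (β : ℂ) = n := mul_left_cancel₀ h2 (by rw [hn]; ring)
  exact hβ n (by exact_mod_cast h3)

/-- For `a, b, c > 0` with `b² - 4ac = 1` and `α, β ∈ ℝ∖ℤ`, there is a function `Z`,
holomorphic on `{Re(s) > 1/2}`, to which the rectangular partial sums
`S_{M,N}(s) = ∑_{p=1}^{M} ∑_{q=0}^{N} e^{2πi(pα+qβ)} Q(p,q)^{-s}` converge locally uniformly
on `{Re(s) > 1/2}` along the product filter; moreover for `Re(s) > 1` the double series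
converges absolutely with sum `Z(s)`. -/
theorem second_kronecker_analyticity (a b c : ℝ) (ha : 0 < a) (hb : 0 < b) (hc : 0 < c)
    (hdisc : b ^ 2 - 4 * a * c = 1) (α β : ℝ)
    (hα : ∀ n : ℤ, α ≠ n) (hβ : ∀ n : ℤ, β ≠ n) :
    ∃ Z : ℂ → ℂ, DifferentiableOn ℂ Z {s : ℂ | 1/2 < s.re} ∧
      TendstoLocallyUniformlyOn
        (fun (MN : ℕ × ℕ) (s : ℂ) =>
          ∑ p ∈ Finset.Icc 1 MN.1, ∑ q ∈ Finset.range (MN.2 + 1),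
            e2pi (p * α + q * β) * ((Qform a b c p q : ℂ) ^ (-s)))
        Z atTop {s : ℂ | 1/2 < s.re} ∧
      ∀ s : ℂ, 1 < s.re →
        Summable (fun pq : ℕ × ℕ =>
          ‖e2pi ((pq.1 + 1) * α + pq.2 * β) *
            ((Qform a b c (pq.1 + 1) pq.2 : ℂ) ^ (-s))‖) ∧
        HasSum (fun pq : ℕ × ℕ =>
          e2pi ((pq.1 + 1) * α + pq.2 * β) *
            ((Qform a b c (pq.1 + 1) pq.2 : ℂ) ^ (-s))) (Z s) := by
  obtain ⟨m, hm, hm1, hQ⟩ := aux_Q a b c ha hb hc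
  have hn1 : ∀ p q : ℕ, (1 : ℝ) ≤ (p : ℝ) + 1 + q := fun p q => by
    linarith [(Nat.cast_nonneg q : (0:ℝ) ≤ q), (Nat.cast_nonneg p : (0:ℝ) ≤ p)]
  have hQ0 : ∀ p q : ℕ, 0 < Qform a b c ((p : ℝ) + 1) q := fun p q =>
    lt_of_lt_of_le (mul_pos hm (pow_pos (by linarith [hn1 p q]) 2)) (hQ p q)
  set f : ℕ → ℕ → ℂ → ℂ := fun p q s => (Qform a b c ((p : ℝ) + 1) q : ℂ) ^ (-s) with hf
  set E : ℕ → ℂ := fun p => e2pi (((p : ℝ) + 1) * α) with hE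
  set w := e2pi β with hw
  have hfb : ∀ σ₀ R : ℝ, 0 ≤ σ₀ → ∀ (p q : ℕ) (s : ℂ), σ₀ ≤ s.re → s.re ≤ R →
      ‖f p q s‖ ≤ m ^ (-R) * ((p : ℝ) + 1 + q) ^ (-(2 * σ₀)) := by
    intro σ₀ R h0 p q s h1 h2
    simp only [hf]
    rw [norm_cpow_eq_rpow_re_of_pos (hQ0 p q), neg_re]
    exact aux_pow m _ _ _ _ _ hm hm1 (hn1 p q) (hQ p q) h0 h1 h2
  have hdb : ∀ σ₀ R : ℝ, 0 < σ₀ → ∀ (p q : ℕ) (s : ℂ), σ₀ ≤ s.re → ‖s‖ ≤ R →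
      ‖f p (q + 1) s - f p q s‖ ≤ R * m ^ (-(R + 1)) * (b + 2 * c) *
        ((p : ℝ) + 1 + q) ^ (-(2 * σ₀ + 1)) := by
    intro σ₀ R h0 p q s h1 h2
    have hp : (0:ℝ) ≤ p := Nat.cast_nonneg p
    have hq : (0:ℝ) ≤ q := Nat.cast_nonneg q
    have hre : s.re ≤ R := (Complex.re_le_norm s).trans h2
    have hdiff : Qform a b c ((p : ℝ) + 1) ((q + 1 : ℕ) : ℝ) - Qform a b c ((p : ℝ) + 1) q
        = b * ((p : ℝ) + 1) + c * (2 * q + 1) := by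
      unfold Qform; push_cast; ring
    have hdiff0 : 0 ≤ b * ((p : ℝ) + 1) + c * (2 * q + 1) := by positivity
    have hdiff1 : b * ((p : ℝ) + 1) + c * (2 * q + 1) ≤ (b + 2 * c) * ((p : ℝ) + 1 + q) := by
      nlinarith [mul_nonneg hb.le hq, mul_nonneg hc.le hp]
    have h3 := aux_cpow s (h0.trans_le h1) _ _ (hQ0 p q)
      (show Qform a b c ((p : ℝ) + 1) q ≤ Qform a b c ((p : ℝ) + 1) ((q + 1 : ℕ) : ℝ) by linarith)
    refine h3.trans ?_
    rw [hdiff]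
    have h4 := aux_pow m _ _ (s.re + 1) (σ₀ + 1) (R + 1) hm hm1 (hn1 p q) (hQ p q) (by linarith)
      (by linarith) (by linarith)
    have hn : 0 < (p : ℝ) + 1 + q := by positivity
    have h5 : ((p : ℝ) + 1 + q) ^ (-(2 * σ₀ + 1)) =
        ((p : ℝ) + 1 + q) ^ (-(2 * (σ₀ + 1))) * ((p : ℝ) + 1 + q) := by
      rw [← Real.rpow_add_one hn.ne']
      congr 1; ring
    rw [h5, show -s.re - 1 = -(s.re + 1) by ring]
    have hR : 0 ≤ R := (norm_nonneg s).trans h2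
    calc _ ≤ R * (m ^ (-(R + 1)) * ((p : ℝ) + 1 + q) ^ (-(2 * (σ₀ + 1)))) *
          ((b + 2 * c) * ((p : ℝ) + 1 + q)) := by
            refine mul_le_mul (mul_le_mul h2 h4 ?_ hR) hdiff1 hdiff0 (by positivity)
            exact Real.rpow_nonneg (hQ0 p q).le _
      _ = _ := by ring
  have hsum : ∀ (MN : ℕ × ℕ) (s : ℂ),
      ∑ p ∈ Finset.Icc 1 MN.1, ∑ q ∈ Finset.range (MN.2 + 1),
            e2pi (p * α + q * β) * ((Qform a b c p q : ℂ) ^ (-s)) =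
      ∑ p ∈ Finset.range MN.1, ∑ q ∈ Finset.range (MN.2 + 1), E p * w ^ q * f p q s := by
    intro MN s
    have h1 : Finset.Icc 1 MN.1 = Finset.Ico (0 + 1) (MN.1 + 1) := by
      ext x; simp [Nat.lt_succ_iff]
    rw [h1, ← Finset.sum_Ico_add', ← Finset.range_eq_Ico]
    refine Finset.sum_congr rfl fun p _ => Finset.sum_congr rfl fun q _ => ?_
    rw [aux_e_mul]
    push_cast
    rfl
  set Z : ℂ → ℂ := fun s => (w - 1)⁻¹ * (0 - (∑' p, E p * f p 0 s) -
        ∑' pq : ℕ × ℕ, E pq.1 * w ^ (pq.2 + 1) * (f pq.1 (pq.2 + 1) s - f pq.1 pq.2 s)) with hZ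
  have hopen : IsOpen {s : ℂ | 1/2 < s.re} := isOpen_lt continuous_const Complex.continuous_re
  have hloc : TendstoLocallyUniformlyOn
        (fun (MN : ℕ × ℕ) (s : ℂ) =>
          ∑ p ∈ Finset.range MN.1, ∑ q ∈ Finset.range (MN.2 + 1), E p * w ^ q * f p q s)
        Z atTop {s : ℂ | 1/2 < s.re} := by
    refine tendstoLocallyUniformlyOn_of_forall_exists_nhds fun s hs => ?_
    have hs' : 1/2 < s.re := hs
    set σ₀ : ℝ := (s.re + 1/2) / 2 with hσ
    have hσ1 : 1/2 < σ₀ := by linarith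
    have hσ2 : σ₀ < s.re := by linarith
    set R := ‖s‖ + 1 with hR
    refine ⟨{z : ℂ | σ₀ < z.re} ∩ {z : ℂ | ‖z‖ < R}, mem_nhdsWithin_of_mem_nhds ?_, ?_⟩
    · exact ((isOpen_lt continuous_const Complex.continuous_re).inter
        (isOpen_lt continuous_norm continuous_const)).mem_nhds ⟨hσ2, by simp [hR]⟩
    have hR0 : 0 < R := by positivity
    set ε := σ₀ - 1/2 with hε
    refine aux_uniform f E (fun p => aux_norm_e _) w (aux_e_ne β hβ) (aux_norm_e β) _
      (fun pq => R * m ^ (-(R + 1)) * (b + 2 * c) *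
        (((pq.1 : ℝ) + 1) ^ (-(σ₀ + 1/2)) * ((pq.2 : ℝ) + 1) ^ (-(σ₀ + 1/2))))
      ((aux_summable2 _ (by linarith)).mul_left _)
      (fun p => m ^ (-R) * ((p : ℝ) + 1) ^ (-(1 + ε)))
      ((aux_summable _ (by linarith)).mul_left _) (fun p => by positivity)
      (fun q => ((q : ℝ) + 1) ^ (-ε)) ?_ (fun q => by positivity) ?_ ?_
    · have h1 := tendsto_rpow_neg_atTop (show 0 < ε by linarith)
      exact h1.comp (tendsto_atTop_add_const_right _ _ tendsto_natCast_atTop_atTop)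
    · intro p q z hz
      refine (hdb σ₀ R (by linarith) p q z hz.1.le hz.2.le).trans ?_
      refine mul_le_mul_of_nonneg_left ?_ (by positivity)
      have := aux_split p q (σ₀ + 1/2) (σ₀ + 1/2) (by linarith) (by linarith)
      rwa [show σ₀ + 1/2 + (σ₀ + 1/2) = 2 * σ₀ + 1 by ring] at this
    · intro p q z hz
      refine (hfb σ₀ R (by linarith) p q z hz.1.le
        ((Complex.re_le_norm z).trans hz.2.le)).trans ?_
      rw [mul_assoc]
      refine mul_le_mul_of_nonneg_left ?_ (by positivity)
      have := aux_split p q (1 + ε) ε (by linarith) (by linarith)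
      rwa [show 1 + ε + ε = 2 * σ₀ by rw [hε]; ring] at this
  refine ⟨Z, ?_, ?_, ?_⟩
  · refine hloc.differentiableOn (Eventually.of_forall fun MN => ?_) hopen
    refine DifferentiableOn.fun_sum fun p _ => DifferentiableOn.fun_sum fun q _ => ?_
    refine DifferentiableOn.const_mul ?_ _
    intro s _
    refine (DifferentiableAt.const_cpow differentiableAt_id.neg (Or.inl ?_)).differentiableWithinAt
    exact_mod_cast (hQ0 p q).ne'
  · simp only [hsum]
    exact hloc
  · intro s hs
    have hterm : (fun pq : ℕ × ℕ => e2pi ((pq.1 + 1) * α + pq.2 * β) *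
            ((Qform a b c (pq.1 + 1) pq.2 : ℂ) ^ (-s))) =
        fun pq : ℕ × ℕ => E pq.1 * w ^ pq.2 * f pq.1 pq.2 s := by
      funext pq
      rw [aux_e_mul]
    have hnorm : Summable (fun pq : ℕ × ℕ => ‖e2pi ((pq.1 + 1) * α + pq.2 * β) *
            ((Qform a b c (pq.1 + 1) pq.2 : ℂ) ^ (-s))‖) := by
      refine Summable.of_nonneg_of_le (fun _ => norm_nonneg _) (fun pq => ?_)
        ((aux_summable2 _ hs).mul_left (m ^ (-s.re)))
      rw [norm_mul, aux_norm_e, one_mul]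
      refine (hfb s.re s.re (by linarith) pq.1 pq.2 s le_rfl le_rfl).trans ?_
      refine mul_le_mul_of_nonneg_left ?_ (by positivity)
      have := aux_split pq.1 pq.2 s.re s.re (by linarith) (by linarith)
      rwa [← two_mul] at this
    refine ⟨hnorm, ?_⟩
    have hs1 := hnorm.of_norm
    rw [hterm] at hs1 ⊢
    have h1 := hs1.hasSum.comp aux_rect1
    have h2 := hloc.tendsto_at (show s ∈ {s : ℂ | 1/2 < s.re} by
      simp only [mem_setOf_eq]; linarith)
    have h3 := tendsto_nhds_unique h1 (h2.congr fun MN => by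
      simp only [Function.comp, Finset.sum_product])
    rw [← h3]
    exact hs1.hasSum

end
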